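/- arXiv:1707.04524 — 6 statements merged into one kernel-verified Lean document; each statement's English description precedes it below -/
import Mathlib

section
/- For all integers n ≥ 2 and m with 1 ≤ m ≤ ⌊n/2⌋, the following alternating binomial sum vanishes: ∑_{j=0}^{⌊n/2⌋} (−1)^j · C(n,j) · C(2n−2j, n) / ∏_{i=1}^{m} (2n − 2j − (2i−1)) = 0, where the identity holds in ℚ (all the factors 2n − 2j − (2i−1) appearing in the denominators are odd positive integers, hence nonzero). -/
open Finset Polynomial in
theorem sum_neg_one_pow_mul_choose_mul_eval_eq_zero {R : Type*} [CommRing R] {P : R[X]} {n : ℕ}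
    (hP : P.natDegree < n) :
    ∑ j ∈ range (n + 1), (-1 : R) ^ j * n.choose j * P.eval (j : R) = 0 := by
  have h := congrFun (Polynomial.fwdDiff_iter_eq_zero_of_degree_lt hP) 0
  rw [fwdDiff_iter_eq_sum_shift, Pi.zero_apply] at h
  have h' := congrArg (fun x => (-1 : R) ^ n * x) h
  simp only [mul_zero, mul_sum] at h'
  rw [← h']
  refine sum_congr rfl fun j hj => ?_
  have hjn : j ≤ n := Nat.lt_succ_iff.mp (mem_range.mp hj)
  have hs : (-1 : R) ^ n * (-1) ^ (n - j) = (-1) ^ j := by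
    rw [← pow_add, show n + (n - j) = j + 2 * (n - j) by lia, pow_add, pow_mul]
    simp
  simp only [zsmul_eq_mul, nsmul_eq_mul, mul_one, zero_add]
  push_cast
  rw [← hs]
  ring

open Finset in
theorem cast_choose_eq_prod_range_sub_div (a n : ℕ) :
    (a.choose n : ℚ) = (∏ k ∈ range n, ((a : ℚ) - k)) / n.factorial := by
  rw [Nat.cast_choose_eq_descPochhammer_div, descPochhammer_eval_eq_prod_range]

open Finset in
theorem image_two_mul_add_one_subset_range {n m : ℕ} (h : 2 * m ≤ n) :
    (range m).image (fun i => 2 * i + 1) ⊆ range n := by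
  intro k hk
  simp only [mem_image, mem_range] at hk ⊢
  lia

open Finset in
/-- The product over the odd numbers below `2 * m` splits off from the product over `range n`. -/
theorem prod_range_eq_prod_odd_mul_prod_sdiff {M : Type*} [CommMonoid M] {n m : ℕ}
    (h : 2 * m ≤ n) (f : ℕ → M) :
    ∏ k ∈ range n, f k = (∏ i ∈ range m, f (2 * i + 1)) *
      ∏ k ∈ range n \ (range m).image (fun i => 2 * i + 1), f k := by
  rw [← prod_sdiff (image_two_mul_add_one_subset_range h), mul_comm,
    prod_image fun a _ b _ hab => by lia]

open Finset Polynomial in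
/-- Lemma 1 (bin1): for `n ≥ 2` and `1 ≤ m ≤ ⌊n/2⌋`, the alternating binomial sum
`∑_{j=0}^{⌊n/2⌋} (−1)^j C(n,j) C(2n−2j,n) / ∏_{i=1}^{m} (2n − 2j − (2i−1))` vanishes in `ℚ`. -/
theorem stmt0 (n m : ℕ) (hn : 2 ≤ n) (hm1 : 1 ≤ m) (hm2 : m ≤ n / 2) :
    ∑ j ∈ Finset.range (n / 2 + 1),
      ((-1 : ℚ) ^ j * (n.choose j) * ((2 * n - 2 * j).choose n)) /
        (∏ i ∈ Finset.range m,
          (2 * (n : ℚ) - 2 * (j : ℚ) - (2 * ((i : ℚ) + 1) - 1))) = 0 := by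
  have h2m : 2 * m ≤ n := by lia
  set s := range n \ (range m).image (fun i => 2 * i + 1) with hs
  let P : ℚ[X] := C ((n.factorial : ℚ)⁻¹) * ∏ k ∈ s, (C (-2) * X + C (2 * (n : ℚ) - k))
  have hcard : #s = n - m := by
    rw [hs, card_sdiff_of_subset (image_two_mul_add_one_subset_range h2m), card_range,
      card_image_of_injective _ fun a b hab => by lia, card_range]
  have hP : P.natDegree < n := by
    calc P.natDegree ≤ (∏ k ∈ s, (C (-2) * X + C (2 * (n : ℚ) - k))).natDegree :=
          natDegree_C_mul_le _ _
      _ ≤ ∑ k ∈ s, (C (-2) * X + C (2 * (n : ℚ) - k)).natDegree := natDegree_prod_le _ _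
      _ ≤ ∑ _k ∈ s, 1 := by
          gcongr
          exact natDegree_linear_le
      _ < n := by rw [← card_eq_sum_ones, hcard]; lia
  rw [← sum_neg_one_pow_mul_choose_mul_eval_eq_zero hP]
  have hsub : range (n / 2 + 1) ⊆ range (n + 1) := range_subset_range.mpr (by lia)
  rw [sum_subset hsub fun j _ hj => by
    rw [mem_range] at hj
    rw [Nat.choose_eq_zero_of_lt (show 2 * n - 2 * j < n by lia)]
    simp]
  refine sum_congr rfl fun j hj => ?_
  have hjn : j ≤ n := Nat.lt_succ_iff.mp (mem_range.mp hj)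
  have hD : (∏ i ∈ range m, (2 * (n : ℚ) - 2 * (j : ℚ) - (2 * ((i : ℚ) + 1) - 1))) ≠ 0 := by
    refine prod_ne_zero_iff.mpr fun i _ h0 => ?_
    have : 2 * (n : ℤ) - 2 * j - (2 * (i + 1) - 1) = 0 := by exact_mod_cast h0
    lia
  have hcast : ((2 * n - 2 * j : ℕ) : ℚ) = 2 * n - 2 * j := by
    rw [Nat.cast_sub (by lia)]
    push_cast
    rfl
  have hE : P.eval (j : ℚ) = (n.factorial : ℚ)⁻¹ * ∏ k ∈ s, (2 * (n : ℚ) - 2 * j - k) := by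
    simp only [P, eval_mul, eval_prod, eval_add, eval_C, eval_X]
    congr 1
    exact prod_congr rfl fun k _ => by ring
  have hO : ∏ i ∈ range m, (2 * (n : ℚ) - 2 * (j : ℚ) - ((2 * i + 1 : ℕ) : ℚ)) =
      ∏ i ∈ range m, (2 * (n : ℚ) - 2 * (j : ℚ) - (2 * ((i : ℚ) + 1) - 1)) :=
    prod_congr rfl fun i _ => by push_cast; ring
  rw [hE, cast_choose_eq_prod_range_sub_div (2 * n - 2 * j) n, hcast,
    prod_range_eq_prod_odd_mul_prod_sdiff h2m, hO, div_eq_iff hD]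
  ring
end

section
/- For every natural number n and every integer j with 0 ≤ j ≤ ⌊n/2⌋, one has the exact identity C(n,j) · C(2n−2j, n) / ∏_{i=1}^{⌊n/2⌋} (2n − 2j − (2i−1)) = 2^{⌈n/2⌉} / ( j! · (⌊n/2⌋ − j)! ), where the identity holds in ℚ (each factor 2n − 2j − (2i−1) in the product is an odd positive integer, hence nonzero). -/
lemma factorial_two_mul_eq_prod_odd (m : ℕ) : ∀ k : ℕ,
    ((2 * (k + m)).factorial : ℚ) * (k.factorial : ℚ) =
      2 ^ m * (∏ i ∈ Finset.range m, (2 * ((k + m : ℕ) : ℚ) - (2 * ((i : ℚ) + 1) - 1))) *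
        ((k + m).factorial : ℚ) * ((2 * k).factorial : ℚ) := by
  induction m with
  | zero => intro k; simp [mul_comm]
  | succ m ih =>
    intro k
    have h := ih (k + 1)
    rw [show k + 1 + m = k + (m + 1) by ring, show 2 * (k + 1) = 2 * k + 1 + 1 by ring,
      Nat.factorial_succ k, Nat.factorial_succ (2 * k + 1), Nat.factorial_succ (2 * k)] at h
    rw [Finset.prod_range_succ]
    have hk : ((k : ℚ) + 1) ≠ 0 := by positivity
    apply mul_left_cancel₀ hk
    generalize (∏ i ∈ Finset.range m,
      (2 * ((k + (m + 1) : ℕ) : ℚ) - (2 * ((i : ℚ) + 1) - 1))) = P at h ⊢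
    push_cast at h ⊢
    linear_combination h

/-- Term-by-term identity used in the proof of Lemma 1: for `0 ≤ j ≤ ⌊n/2⌋`,
`C(n,j) C(2n−2j,n) / ∏_{i=1}^{⌊n/2⌋} (2n − 2j − (2i−1)) = 2^{⌈n/2⌉} / (j! (⌊n/2⌋ − j)!)` in `ℚ`. -/
theorem stmt1 (n j : ℕ) (hj : j ≤ n / 2) :
    ((n.choose j : ℚ) * ((2 * n - 2 * j).choose n)) /
      (∏ i ∈ Finset.range (n / 2),
        (2 * (n : ℚ) - 2 * (j : ℚ) - (2 * ((i : ℚ) + 1) - 1)))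
    = (2 : ℚ) ^ ((n + 1) / 2) / ((j.factorial : ℚ) * ((n / 2 - j).factorial : ℚ)) := by
  obtain ⟨d, hd⟩ := Nat.exists_eq_add_of_le hj
  obtain ⟨e, he, hn⟩ : ∃ e, e < 2 ∧ n = 2 * (j + d) + e := ⟨n % 2, by omega, by omega⟩
  have hN : n - j = d + e + (j + d) := by omega
  have h := factorial_two_mul_eq_prod_odd (j + d) (d + e)
  have hcast : (2 * (n : ℚ) - 2 * (j : ℚ)) = 2 * ((d + e + (j + d) : ℕ) : ℚ) := by
    rw [hn]; push_cast; ring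
  rw [hcast, hd, show j + d - j = d by omega, Nat.cast_choose ℚ (show j ≤ n by omega),
    Nat.cast_choose ℚ (show n ≤ 2 * n - 2 * j by omega), hN,
    show 2 * n - 2 * j - n = 2 * d + e by omega,
    show 2 * n - 2 * j = 2 * (d + e + (j + d)) by omega]
  have hP : (∏ i ∈ Finset.range (j + d),
      (2 * ((d + e + (j + d) : ℕ) : ℚ) - (2 * ((i : ℚ) + 1) - 1))) ≠ 0 := by
    refine (Finset.prod_pos fun i hi => ?_).ne'
    have hi' : (i : ℚ) + 1 ≤ ((d + e + (j + d) : ℕ) : ℚ) := by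
      have := Finset.mem_range.mp hi
      exact_mod_cast (by omega : i + 1 ≤ d + e + (j + d))
    linarith
  generalize (∏ i ∈ Finset.range (j + d),
      (2 * ((d + e + (j + d) : ℕ) : ℚ) - (2 * ((i : ℚ) + 1) - 1))) = P at h hP ⊢
  have hf (a : ℕ) : (a.factorial : ℚ) ≠ 0 := by exact_mod_cast a.factorial_ne_zero
  have key : (2 : ℚ) ^ (j + d) * ((2 * (d + e)).factorial : ℚ) * (d.factorial : ℚ) =
      2 ^ ((n + 1) / 2) * ((2 * d + e).factorial : ℚ) * ((d + e).factorial : ℚ) := by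
    interval_cases e
    · rw [show (n + 1) / 2 = j + d by omega]
      simp only [add_zero]
    · rw [show (n + 1) / 2 = j + d + 1 by omega, show 2 * (d + 1) = 2 * d + 1 + 1 by ring,
        Nat.factorial_succ (2 * d + 1), Nat.factorial_succ d]
      push_cast
      ring
  have h1 := hf n
  have h2 := hf j
  have h3 := hf d
  have h4 := hf (d + e + (j + d))
  have h5 := hf (2 * d + e)
  have h6 := hf (d + e)
  rw [div_mul_div_comm, div_div, div_eq_div_iff (by positivity) (by positivity)]
  apply mul_left_cancel₀ h6
  linear_combination (n.factorial : ℚ) * j.factorial * d.factorial * h +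
    (n.factorial : ℚ) * j.factorial * P * (d + e + (j + d)).factorial * key
end

section
/- For every natural number n and every integer k with 0 ≤ k ≤ ⌊n/2⌋, the binomial coefficients satisfy C(n,k) · C(2n−2k, n) ≤ 2^n · (1+√2)^n as real numbers. Equivalently, the coefficient d_k^{(n)} = (−1)^k C(n,k) C(2n−2k,n)/2^n of the monomial z^{n−2k} in the Legendre polynomial P_n(z) satisfies |d_k^{(n)}| ≤ (1+√2)^n. -/
theorem Nat.choose_mul_choose_two_mul_sub (k d : ℕ) :
    (2 * k + d).choose k * (2 * (k + d)).choose (2 * k + d) =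
      (k + d).centralBinom * (k + d).choose k := by
  have h₁ := Nat.choose_mul (n := 2 * (k + d)) (k := 2 * k + d) (s := k) (by lia)
  have h₂ := Nat.choose_mul (n := 2 * (k + d)) (k := k + d) (s := k) (by lia)
  have h₃ : (2 * (k + d) - k).choose (2 * k + d - k) = (2 * (k + d) - k).choose (k + d - k) :=
    Nat.choose_symm_of_eq_add (by lia)
  rw [Nat.centralBinom, h₂, mul_comm, h₁, h₃]

theorem four_pow_mul_choose_le {x : ℝ} (hx : 0 < x) (hx2 : x * x = 4 * (x + 1)) (k d : ℕ) :
    4 ^ (k + d) * ((k + d).choose k : ℝ) ≤ x ^ (2 * k + d) := by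
  have hle : ((k + d).choose k : ℝ) * x ^ d ≤ (x + 1) ^ (k + d) := by
    rw [add_pow]
    refine le_of_eq_of_le ?_ (Finset.single_le_sum (fun i _ => by positivity)
      (Finset.mem_range.2 (by lia : d < k + d + 1)))
    rw [Nat.choose_symm_add, one_pow]
    ring
  refine le_of_mul_le_mul_right ?_ (pow_pos hx d)
  calc 4 ^ (k + d) * ((k + d).choose k : ℝ) * x ^ d
      = 4 ^ (k + d) * (((k + d).choose k : ℝ) * x ^ d) := mul_assoc _ _ _
    _ ≤ 4 ^ (k + d) * (x + 1) ^ (k + d) := by gcongr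
    _ = x ^ (2 * k + d) * x ^ d := by rw [← mul_pow, ← hx2]; ring

/-- Lemma 2 (bin2): for `0 ≤ k ≤ ⌊n/2⌋`,
`C(n,k) · C(2n−2k, n) ≤ 2^n (1+√2)^n` as real numbers; equivalently, the coefficient
`d_k^{(n)} = (−1)^k C(n,k) C(2n−2k,n)/2^n` of `z^{n−2k}` in the Legendre polynomial `P_n`
satisfies `|d_k^{(n)}| ≤ (1+√2)^n`. -/
theorem stmt2 (n k : ℕ) (hk : k ≤ n / 2) :
    ((n.choose k : ℝ) * ((2 * n - 2 * k).choose n : ℝ)) ≤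
      2 ^ n * (1 + Real.sqrt 2) ^ n := by
  obtain ⟨d, rfl⟩ : ∃ d, n = 2 * k + d := ⟨n - 2 * k, by lia⟩
  have hsub : 2 * (2 * k + d) - 2 * k = 2 * (k + d) := by lia
  have hsq : (2 * (1 + √2)) * (2 * (1 + √2)) = 4 * (2 * (1 + √2) + 1) := by
    linear_combination 4 * Real.mul_self_sqrt (zero_le_two (α := ℝ))
  rw [hsub, ← mul_pow]
  calc ((2 * k + d).choose k : ℝ) * ((2 * (k + d)).choose (2 * k + d) : ℝ)
      = ((k + d).centralBinom : ℝ) * ((k + d).choose k : ℝ) := by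
        exact_mod_cast Nat.choose_mul_choose_two_mul_sub k d
    _ ≤ 4 ^ (k + d) * ((k + d).choose k : ℝ) := by
        gcongr
        exact_mod_cast Nat.centralBinom_le_four_pow (k + d)
    _ ≤ (2 * (1 + √2)) ^ (2 * k + d) := four_pow_mul_choose_le (by positivity) hsq k d
end

section
/- Let (P_n) be the sequence of Legendre polynomials over ℝ, and let a_j^{(n)} denote the coefficient of X^j in P_n. Then for all n ≥ 0 and all j with 0 ≤ j ≤ n, |a_j^{(n)}| ≤ (1+√2)^n; i.e., every coefficient of the degree-n Legendre polynomial is bounded in absolute value by (1+√2)^n. -/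
open Polynomial

/-- The Legendre polynomials over `ℝ`: `P 0 = 1`, `P 1 = X`, and
`(n+1)·P (n+1) = (2n+1)·X·P n − n·P (n−1)` for `n ≥ 1`. -/
noncomputable def legendre : ℕ → Polynomial ℝ
  | 0 => 1
  | 1 => X
  | (n + 2) =>
      C ((2 * (n : ℝ) + 3) / ((n : ℝ) + 2)) * X * legendre (n + 1)
        - C (((n : ℝ) + 1) / ((n : ℝ) + 2)) * legendre n

theorem legendre_add_two (n : ℕ) :
    legendre (n + 2) = C ((2 * (n : ℝ) + 3) / ((n : ℝ) + 2)) * X * legendre (n + 1)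
      - C (((n : ℝ) + 1) / ((n : ℝ) + 2)) * legendre n := by
  rw [legendre]

theorem abs_coeff_X_mul_le {p : Polynomial ℝ} {B : ℝ} (h : ∀ j, |p.coeff j| ≤ B) (j : ℕ) :
    |(X * p).coeff j| ≤ B := by
  cases j with
  | zero => simpa using (abs_nonneg _).trans (h 0)
  | succ j => simpa only [coeff_X_mul] using h j

theorem abs_coeff_legendre_add_two_le {n : ℕ} {A B : ℝ}
    (hA : ∀ j, |(legendre n).coeff j| ≤ A) (hB : ∀ j, |(legendre (n + 1)).coeff j| ≤ B) (j : ℕ) :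
    |(legendre (n + 2)).coeff j| ≤ 2 * B + A := by
  have hn : (0 : ℝ) < n + 2 := by positivity
  have h1 : |(2 * (n : ℝ) + 3) / (n + 2)| ≤ 2 := by
    rw [abs_of_nonneg (by positivity), div_le_iff₀ hn]
    linarith
  have h2 : |((n : ℝ) + 1) / (n + 2)| ≤ 1 := by
    rw [abs_of_nonneg (by positivity), div_le_iff₀ hn]
    linarith
  rw [legendre_add_two, coeff_sub, mul_assoc, coeff_C_mul, coeff_C_mul]
  refine (abs_sub _ _).trans (add_le_add ?_ ?_)
  · rw [abs_mul]
    exact mul_le_mul h1 (abs_coeff_X_mul_le hB j) (abs_nonneg _) zero_le_two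
  · rw [abs_mul, ← one_mul A]
    exact mul_le_mul h2 (hA j) (abs_nonneg _) zero_le_one

theorem one_add_sqrt_two_pow_add_two (n : ℕ) :
    (1 + Real.sqrt 2) ^ (n + 2) = 2 * (1 + Real.sqrt 2) ^ (n + 1) + (1 + Real.sqrt 2) ^ n := by
  have h : Real.sqrt 2 ^ 2 = 2 := Real.sq_sqrt zero_le_two
  linear_combination (1 + Real.sqrt 2) ^ n * h

theorem abs_coeff_legendre_le (n : ℕ) :
    ∀ j, |(legendre n).coeff j| ≤ (1 + Real.sqrt 2) ^ n := by
  induction n using Nat.twoStepInduction with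
  | zero =>
    intro j
    rw [legendre, coeff_one]
    split_ifs <;> simp
  | one =>
    intro j
    have h := Real.sqrt_nonneg 2
    rw [legendre, coeff_X, pow_one]
    split_ifs <;> simp <;> linarith
  | more n hA hB =>
    intro j
    rw [one_add_sqrt_two_pow_add_two]
    exact abs_coeff_legendre_add_two_le hA hB j

/-- Uniform coefficient bound for the Legendre polynomials: for all `n` and `0 ≤ j ≤ n`,
`|a_j^{(n)}| ≤ (1+√2)^n`. -/
theorem stmt4 (n j : ℕ) (hj : j ≤ n) :
    |(legendre n).coeff j| ≤ (1 + Real.sqrt 2) ^ n :=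
  abs_coeff_legendre_le n j
end

section
/- Let r > 0, R > 0 and α be real numbers, and define a sequence B : ℕ → ℝ by B_0 = 1/R and, for n ≥ 1, the two-term recursion n·R²·B_n = (2n−1)·α·B_{n−1} − (n−1)·r²·B_{n−2} (with the convention B_{−1} = 0). Then for every n ≥ 0, B_n = (r^n / R^{n+1}) · P_n(α/(r·R)), where P_n is the Legendre polynomial of degree n. -/
open Polynomial

/-- Closed form for the Duan–Krasny recursion: if `B 0 = 1/R` and
`n·R²·Bₙ = (2n−1)·α·B_{n−1} − (n−1)·r²·B_{n−2}` for `n ≥ 1` (the `n = 1` case does not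
involve `B_{−1}` since its coefficient `n − 1` vanishes), then
`Bₙ = (rⁿ/R^{n+1}) Pₙ(α/(rR))` for all `n`. -/
theorem stmt7 (r R α : ℝ) (hr : 0 < r) (hR : 0 < R) (B : ℕ → ℝ)
    (hB0 : B 0 = 1 / R)
    (hrec : ∀ n : ℕ, 1 ≤ n →
      (n : ℝ) * R ^ 2 * B n =
        (2 * (n : ℝ) - 1) * α * B (n - 1) - ((n : ℝ) - 1) * r ^ 2 * B (n - 2)) :
    ∀ n : ℕ, B n = (r ^ n / R ^ (n + 1)) * (legendre n).eval (α / (r * R)) := by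
  have hr0 := hr.ne'
  have hR0 := hR.ne'
  intro n
  induction n using Nat.twoStepInduction with
  | zero => simp [legendre, hB0]
  | one =>
    have h := hrec 1 le_rfl
    norm_num [hB0] at h
    simp only [legendre, eval_X]
    field_simp at h ⊢
    linear_combination h
  | more n ih0 ih1 =>
    have h := hrec (n + 2) (by omega)
    have e1 : n + 2 - 1 = n + 1 := rfl
    rw [e1, Nat.add_sub_cancel, ih0, ih1] at h
    push_cast at h
    have hn : (n : ℝ) + 2 ≠ 0 := by positivity
    have hc : ((n : ℝ) + 2) * R ^ 2 ≠ 0 := by positivity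
    refine mul_left_cancel₀ hc (h.trans ?_)
    simp only [legendre, eval_sub, eval_mul, eval_C, eval_X]
    field_simp
    ring
end

section
/- Let c > 0 and R̄ > 0 be real numbers, let K be an even natural number, set s = K/2 + 1, and let q be an integer. Then ∫_0^{R̄} r^{K+1} · (c² + r²)^{−(2q+1)/2} dr = −∑_{m=1}^{s} ( ∏_{i=1}^{m−1} (K − 2i + 2) / ∏_{i=1}^{m} (2q − 2i + 1) ) · R̄^{K−2m+2} · (c² + R̄²)^{−(2q−2m+1)/2} + ( ∏_{i=1}^{s−1} (K − 2i + 2) / ∏_{i=1}^{s} (2q − 2i + 1) ) · c^{−(2q−2s+1)}, where all powers with half-integer or negative exponents are real powers of positive bases (which makes every term well-defined since c > 0), and all the factors 2q − 2i + 1 are odd integers, hence nonzero. -/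
open Finset in
@[to_additive]
theorem prod_Icc_eq_prod_range_succ {M : Type*} [CommMonoid M] (f : ℕ → M) (m : ℕ) :
    ∏ i ∈ Icc 1 m, f i = ∏ i ∈ range m, f (i + 1) := by
  rw [range_eq_Ico, prod_Ico_add' f 0 m 1, zero_add, Ico_add_one_right_eq_Icc]

theorem hasDerivAt_sq_add_sq_rpow {c : ℝ} (hc : 0 < c) {a : ℝ} (ha : 2 * a - 1 ≠ 0) (r : ℝ) :
    HasDerivAt (fun r : ℝ => -(c ^ 2 + r ^ 2) ^ (-(2 * a - 1) / 2) / (2 * a - 1))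
      (r * (c ^ 2 + r ^ 2) ^ (-(2 * a + 1) / 2)) r := by
  have hpos : 0 < c ^ 2 + r ^ 2 := by positivity
  have h : HasDerivAt (fun r : ℝ => c ^ 2 + r ^ 2) (2 * r) r := by
    simpa using (hasDerivAt_pow 2 r).const_add (c ^ 2)
  refine ((h.rpow_const (p := -(2 * a - 1) / 2) (Or.inl hpos.ne')).neg.div_const
    (2 * a - 1)).congr_deriv ?_
  rw [show -(2 * a - 1) / 2 - 1 = -(2 * a + 1) / 2 by ring]
  field_simp

theorem continuous_sq_add_sq_rpow {c : ℝ} (hc : 0 < c) (p : ℝ) :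
    Continuous fun r : ℝ => (c ^ 2 + r ^ 2) ^ p :=
  Continuous.rpow_const (by fun_prop) fun r => Or.inl (by positivity)

theorem sq_rpow_neg_half {c : ℝ} (hc : 0 < c) (x : ℝ) : (c ^ 2) ^ (-x / 2) = c ^ (-x) := by
  rw [← Real.rpow_natCast, ← Real.rpow_mul hc.le]
  congr 1
  push_cast
  ring

theorem integral_mul_sq_add_sq_rpow {c : ℝ} (hc : 0 < c) (R : ℝ) {a : ℝ} (ha : 2 * a - 1 ≠ 0) :
    (∫ r in (0 : ℝ)..R, r * (c ^ 2 + r ^ 2) ^ (-(2 * a + 1) / 2)) =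
      -((c ^ 2 + R ^ 2) ^ (-(2 * a - 1) / 2) / (2 * a - 1)) +
        c ^ (-(2 * a - 1)) / (2 * a - 1) := by
  rw [intervalIntegral.integral_eq_sub_of_hasDerivAt
    (fun r _ => hasDerivAt_sq_add_sq_rpow hc ha r)
    ((continuous_id.mul (continuous_sq_add_sq_rpow hc _)).intervalIntegrable 0 R)]
  rw [← sq_rpow_neg_half hc]
  simp only [ne_eq, OfNat.ofNat_ne_zero, not_false_eq_true, zero_pow, add_zero]
  ring

theorem integral_pow_mul_sq_add_sq_rpow_succ {c : ℝ} (hc : 0 < c) (R : ℝ) {a : ℝ}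
    (ha : 2 * a - 1 ≠ 0) (n : ℕ) :
    (∫ r in (0 : ℝ)..R, r ^ (n + 3) * (c ^ 2 + r ^ 2) ^ (-(2 * a + 1) / 2)) =
      -(R ^ (n + 2) * (c ^ 2 + R ^ 2) ^ (-(2 * a - 1) / 2) / (2 * a - 1)) +
        (n + 2) / (2 * a - 1) *
          ∫ r in (0 : ℝ)..R, r ^ (n + 1) * (c ^ 2 + r ^ 2) ^ (-(2 * (a - 1) + 1) / 2) := by
  have hparts := intervalIntegral.integral_mul_deriv_eq_deriv_mul (a := 0) (b := R)
    (fun r _ => hasDerivAt_pow (n + 2) r) (fun r _ => hasDerivAt_sq_add_sq_rpow hc ha r)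
    ((by fun_prop : Continuous fun r : ℝ => ((n + 2 : ℕ) : ℝ) * r ^ (n + 2 - 1)).intervalIntegrable
      0 R)
    ((continuous_id.mul (continuous_sq_add_sq_rpow hc _)).intervalIntegrable 0 R)
  have hleft : ∀ r : ℝ, r ^ (n + 3) * (c ^ 2 + r ^ 2) ^ (-(2 * a + 1) / 2) =
      r ^ (n + 2) * (r * (c ^ 2 + r ^ 2) ^ (-(2 * a + 1) / 2)) := fun r => by ring
  have hright : ∀ r : ℝ, ((n + 2 : ℕ) : ℝ) * r ^ (n + 2 - 1) *
        (-(c ^ 2 + r ^ 2) ^ (-(2 * a - 1) / 2) / (2 * a - 1)) =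
      -((n + 2) / (2 * a - 1)) *
        (r ^ (n + 1) * (c ^ 2 + r ^ 2) ^ (-(2 * (a - 1) + 1) / 2)) := fun r => by
    rw [show -(2 * (a - 1) + 1) / 2 = -(2 * a - 1) / 2 by ring, Nat.add_succ_sub_one]
    push_cast
    ring
  simp_rw [hleft]
  rw [hparts]
  simp_rw [hright]
  rw [intervalIntegral.integral_const_mul, zero_pow (by positivity)]
  ring

open Finset in
theorem integral_odd_pow_mul_sq_add_sq_rpow {c : ℝ} (hc : 0 < c) (R : ℝ) (n : ℕ) (a : ℝ)
    (ha : ∀ i : ℕ, 2 * a - 2 * i - 1 ≠ 0) :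
    (∫ r in (0 : ℝ)..R, r ^ (2 * n + 1) * (c ^ 2 + r ^ 2) ^ (-(2 * a + 1) / 2)) =
      -(∑ m ∈ range (n + 1),
          ((∏ i ∈ range m, (2 * (n : ℝ) - 2 * i)) /
            (∏ i ∈ range (m + 1), (2 * a - 2 * i - 1))) *
          R ^ (2 * (n : ℝ) - 2 * m) * (c ^ 2 + R ^ 2) ^ (-(2 * a - 2 * m - 1) / 2)) +
      ((∏ i ∈ range n, (2 * (n : ℝ) - 2 * i)) /
          (∏ i ∈ range (n + 1), (2 * a - 2 * i - 1))) * c ^ (-(2 * a - 2 * n - 1)) := by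
  induction n generalizing a with
  | zero =>
    have h := integral_mul_sq_add_sq_rpow hc R (a := a) (by simpa using ha 0)
    simp only [mul_zero, zero_add, pow_one, h, sum_range_one, prod_range_zero, prod_range_one,
      Nat.cast_zero, sub_zero, Real.rpow_zero]
    ring
  | succ n ih =>
    have ha0 : 2 * a - 1 ≠ 0 := by simpa using ha 0
    have hnum : ∀ m : ℕ, ∏ i ∈ range (m + 1), (2 * ((n + 1 : ℕ) : ℝ) - 2 * i) =
        (2 * n + 2) * ∏ i ∈ range m, (2 * (n : ℝ) - 2 * i) := fun m => by
      rw [prod_range_succ', mul_comm]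
      congr 1
      · push_cast; ring
      · exact prod_congr rfl fun i _ => by push_cast; ring
    have hden : ∀ m : ℕ, ∏ i ∈ range (m + 1), (2 * a - 2 * i - 1) =
        (2 * a - 1) * ∏ i ∈ range m, (2 * (a - 1) - 2 * i - 1) := fun m => by
      rw [prod_range_succ', mul_comm]
      congr 1
      · push_cast; ring
      · exact prod_congr rfl fun i _ => by push_cast; ring
    have hRpow : R ^ (2 * ((n + 1 : ℕ) : ℝ) - 2 * ((0 : ℕ) : ℝ)) = R ^ (2 * n + 2) := by
      rw [← Real.rpow_natCast]
      congr 1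
      push_cast
      ring
    have hsum : ∀ m : ℕ,
        ((∏ i ∈ range (m + 1), (2 * ((n + 1 : ℕ) : ℝ) - 2 * i)) /
            (∏ i ∈ range (m + 1 + 1), (2 * a - 2 * i - 1))) *
          R ^ (2 * ((n + 1 : ℕ) : ℝ) - 2 * ((m + 1 : ℕ) : ℝ)) *
          (c ^ 2 + R ^ 2) ^ (-(2 * a - 2 * ((m + 1 : ℕ) : ℝ) - 1) / 2) =
        (2 * n + 2) / (2 * a - 1) *
          (((∏ i ∈ range m, (2 * (n : ℝ) - 2 * i)) /
            (∏ i ∈ range (m + 1), (2 * (a - 1) - 2 * i - 1))) *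
          R ^ (2 * (n : ℝ) - 2 * m) *
          (c ^ 2 + R ^ 2) ^ (-(2 * (a - 1) - 2 * m - 1) / 2)) := fun m => by
      rw [hnum, hden, mul_div_mul_comm,
        show 2 * ((n + 1 : ℕ) : ℝ) - 2 * ((m + 1 : ℕ) : ℝ) = 2 * (n : ℝ) - 2 * m by
          push_cast; ring,
        show 2 * a - 2 * ((m + 1 : ℕ) : ℝ) - 1 = 2 * (a - 1) - 2 * m - 1 by push_cast; ring]
      ring
    rw [show 2 * (n + 1) + 1 = 2 * n + 3 by ring,
      integral_pow_mul_sq_add_sq_rpow_succ hc R ha0 (2 * n),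
      ih (a - 1) fun i h => ha (i + 1) (by push_cast; linarith),
      sum_range_succ' _ (n + 1), sum_congr rfl fun m _ => hsum m, ← mul_sum, hnum n,
      hden (n + 1), mul_div_mul_comm, hRpow,
      show 2 * a - 2 * ((n + 1 : ℕ) : ℝ) - 1 = 2 * (a - 1) - 2 * n - 1 by push_cast; ring]
    simp only [zero_add, prod_range_zero, prod_range_one, Nat.cast_zero, mul_zero, sub_zero]
    push_cast
    ring

/-- Closed form (via `s` integrations by parts) for
`∫_0^{R̄} r^{K+1} (c²+r²)^{−(2q+1)/2} dr`, with `K` even, `s = K/2 + 1`, `q ∈ ℤ`. -/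
theorem stmt8 (c Rb : ℝ) (hc : 0 < c) (hRb : 0 < Rb) (K : ℕ) (hK : Even K) (q : ℤ)
    (s : ℕ) (hs : s = K / 2 + 1) :
    (∫ r in (0 : ℝ)..Rb, r ^ (K + 1) * (c ^ 2 + r ^ 2) ^ (-(2 * (q : ℝ) + 1) / 2)) =
      -(∑ m ∈ Finset.Icc 1 s,
          ((∏ i ∈ Finset.Icc 1 (m - 1), ((K : ℝ) - 2 * (i : ℝ) + 2)) /
            (∏ i ∈ Finset.Icc 1 m, (2 * (q : ℝ) - 2 * (i : ℝ) + 1))) *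
          Rb ^ ((K : ℝ) - 2 * (m : ℝ) + 2) *
          (c ^ 2 + Rb ^ 2) ^ (-(2 * (q : ℝ) - 2 * (m : ℝ) + 1) / 2))
      + ((∏ i ∈ Finset.Icc 1 (s - 1), ((K : ℝ) - 2 * (i : ℝ) + 2)) /
          (∏ i ∈ Finset.Icc 1 s, (2 * (q : ℝ) - 2 * (i : ℝ) + 1))) *
        c ^ (-(2 * (q : ℝ) - 2 * (s : ℝ) + 1)) := by
  obtain ⟨n, rfl⟩ := hK.two_dvd
  obtain rfl : s = n + 1 := by omega
  have ha : ∀ i : ℕ, 2 * (q : ℝ) - 2 * i - 1 ≠ 0 := fun i h => by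
    have : 2 * q - 2 * (i : ℤ) - 1 = 0 := by exact_mod_cast h
    omega
  rw [integral_odd_pow_mul_sq_add_sq_rpow hc Rb n q ha, sum_Icc_eq_sum_range_succ]
  have hnum : ∀ i : ℕ, ((2 * n : ℕ) : ℝ) - 2 * ((i + 1 : ℕ) : ℝ) + 2 = 2 * (n : ℝ) - 2 * i :=
    fun i => by push_cast; ring
  have hden : ∀ i : ℕ, 2 * (q : ℝ) - 2 * ((i + 1 : ℕ) : ℝ) + 1 = 2 * (q : ℝ) - 2 * i - 1 :=
    fun i => by push_cast; ring
  simp only [prod_Icc_eq_prod_range_succ, hnum, hden, Nat.add_sub_cancel]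
end
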